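/- If vertices u, v, w belong to the same connected component of a graph G, then G contains an induced subgraph that is a connector with tips u, v, w, i.e., an induced subgraph formed from three disjoint paths Q1, Q2, Q3 ending at u, v, w respectively, whose other endpoints a1, a2, a3 either are identified into a single vertex or form a triangle, with no other edges present. -/

import Mathlib

open SimpleGraph

/-- `HasInducedConnector G u v w` : `G` contains an induced connector with tips `u, v, w`:
three induced paths (legs) `Q₁, Q₂, Q₃` from the tips `u, v, w` to endpoints `a₁, a₂, a₃`,
where either `a₁, a₂, a₃` are identified into a single center vertex, or they are pairwise
distinct and form a triangle; the legs meet only at the center, and the only edges of `G`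
among the vertices of the connector are the edges of the legs and the center triangle edges. -/
def HasInducedConnector {V : Type*} (G : SimpleGraph V) (u v w : V) : Prop :=
  ∃ (a₁ a₂ a₃ : V) (Q₁ : G.Walk u a₁) (Q₂ : G.Walk v a₂) (Q₃ : G.Walk w a₃),
    Q₁.IsPath ∧ Q₂.IsPath ∧ Q₃.IsPath ∧
    ((a₁ = a₂ ∧ a₂ = a₃) ∨
      (a₁ ≠ a₂ ∧ a₁ ≠ a₃ ∧ a₂ ≠ a₃ ∧ G.Adj a₁ a₂ ∧ G.Adj a₁ a₃ ∧ G.Adj a₂ a₃)) ∧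
    (∀ x, x ∈ Q₁.support → x ∈ Q₂.support → x = a₁) ∧
    (∀ x, x ∈ Q₁.support → x ∈ Q₃.support → x = a₁) ∧
    (∀ x, x ∈ Q₂.support → x ∈ Q₃.support → x = a₂) ∧
    (∀ x y, (x ∈ Q₁.support ∨ x ∈ Q₂.support ∨ x ∈ Q₃.support) →
      (y ∈ Q₁.support ∨ y ∈ Q₂.support ∨ y ∈ Q₃.support) → G.Adj x y →
      s(x, y) ∈ Q₁.edges ∨ s(x, y) ∈ Q₂.edges ∨ s(x, y) ∈ Q₃.edges ∨
      s(x, y) = s(a₁, a₂) ∨ s(x, y) = s(a₁, a₃) ∨ s(x, y) = s(a₂, a₃))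

namespace ConnAux

variable {V : Type*} {G : SimpleGraph V}

theorem tri {a b c : V} (h : G.Reachable a b) (h' : G.Reachable b c) :
    G.dist a c ≤ G.dist a b + G.dist b c := by
  obtain ⟨p, hp⟩ := h.exists_walk_length_eq_dist
  obtain ⟨q, hq⟩ := h'.exists_walk_length_eq_dist
  rw [← hp, ← hq, ← Walk.length_append]
  exact dist_le _

theorem getVert_edge {a b : V} (p : G.Walk a b) {i : ℕ} (hi : i < p.length) :
    s(p.getVert i, p.getVert (i + 1)) ∈ p.edges := by
  induction p generalizing i with
  | nil => simp at hi
  | cons h q ih =>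
    cases i with
    | zero => simp
    | succ i =>
      simp only [Walk.getVert_cons_succ, Walk.edges_cons, List.mem_cons]
      exact Or.inr (ih (by simpa using hi))

theorem geo_split {a b x : V} {p : G.Walk a b} (hp : p.length = G.dist a b)
    (hx : x ∈ p.support) : G.Reachable a x ∧ G.Reachable x b ∧
      G.dist a x + G.dist x b = G.dist a b := by
  classical
  have h1 : G.Reachable a x := ⟨p.takeUntil x hx⟩
  have h2 : G.Reachable x b := ⟨p.dropUntil x hx⟩
  refine ⟨h1, h2, le_antisymm ?_ (tri h1 h2)⟩
  have e := congrArg Walk.length (p.take_spec hx)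
  rw [Walk.length_append] at e
  have := dist_le (p.takeUntil x hx)
  have := dist_le (p.dropUntil x hx)
  omega

theorem geo_take [DecidableEq V] {a b x : V} {p : G.Walk a b} (hp : p.length = G.dist a b)
    (hx : x ∈ p.support) : (p.takeUntil x hx).length = G.dist a x := by
  have e := congrArg Walk.length (p.take_spec hx)
  rw [Walk.length_append] at e
  have := dist_le (p.takeUntil x hx)
  have := dist_le (p.dropUntil x hx)
  have := geo_split hp hx
  omega

theorem geo_getVert {a b : V} {p : G.Walk a b} (hp : p.length = G.dist a b)
    {i : ℕ} (hi : i ≤ p.length) : G.dist a (p.getVert i) = i := by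
  have h := geo_split hp (p.getVert_mem_support i)
  have h1 := dist_le (p.take i)
  have h2 := dist_le (p.drop i)
  rw [Walk.take_length] at h1
  rw [Walk.drop_length] at h2
  omega

theorem geo_uniq {a b x y : V} {p : G.Walk a b} (hp : p.length = G.dist a b)
    (hx : x ∈ p.support) (hy : y ∈ p.support) (h : G.dist x b = G.dist y b) : x = y := by
  have h1 := geo_split hp hx
  have h2 := geo_split hp hy
  obtain ⟨i, rfl, hi⟩ := Walk.mem_support_iff_exists_getVert.1 hx
  obtain ⟨j, rfl, hj⟩ := Walk.mem_support_iff_exists_getVert.1 hy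
  have h3 := geo_getVert hp hi
  have h4 := geo_getVert hp hj
  have : i = j := by omega
  rw [this]

theorem geo_edge {a b x y : V} {p : G.Walk a b} (hp : p.length = G.dist a b)
    (hx : x ∈ p.support) (hy : y ∈ p.support) (h : G.Adj x y) : s(x, y) ∈ p.edges := by
  have h1 := geo_split hp hx
  have h2 := geo_split hp hy
  obtain ⟨i, rfl, hi⟩ := Walk.mem_support_iff_exists_getVert.1 hx
  obtain ⟨j, rfl, hj⟩ := Walk.mem_support_iff_exists_getVert.1 hy
  have h3 := geo_getVert hp hi
  have h4 := geo_getVert hp hj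
  have h5 := tri h1.1 h.reachable
  have h6 := tri h2.1 h.symm.reachable
  have e := dist_eq_one_iff_adj.2 h
  have e' := dist_eq_one_iff_adj.2 h.symm
  have hne : i ≠ j := by rintro rfl; exact h.ne rfl
  rcases lt_or_gt_of_ne hne with hl | hl
  · obtain rfl : j = i + 1 := by omega
    exact getVert_edge p (by omega)
  · obtain rfl : i = j + 1 := by omega
    rw [Sym2.eq_swap]
    exact getVert_edge p (by omega)

def Med (G : SimpleGraph V) (u v w c : V) : Prop :=
  G.Reachable u c ∧ G.Reachable v c ∧ G.Reachable w c ∧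
  ∀ x, G.Reachable c x →
    G.dist u c + G.dist v c + G.dist w c ≤ G.dist u x + G.dist v x + G.dist w x

theorem Med.s12 {u v w c : V} (h : Med G u v w c) : Med G v u w c :=
  ⟨h.2.1, h.1, h.2.2.1, fun x hx => by have := h.2.2.2 x hx; omega⟩

theorem Med.s23 {u v w c : V} (h : Med G u v w c) : Med G u w v c :=
  ⟨h.1, h.2.2.1, h.2.1, fun x hx => by have := h.2.2.2 x hx; omega⟩

theorem cross {u v w c x y : V} (h : Med G u v w c) {P : G.Walk u c} {Q : G.Walk v c}
    (hP : P.length = G.dist u c) (hQ : Q.length = G.dist v c)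
    (hx : x ∈ P.support) (hy : y ∈ Q.support) (hxy : G.Adj x y) (hxc : x ≠ c) (hyc : y ≠ c) :
    G.dist x c = 1 ∧ G.dist y c = 1 := by
  obtain ⟨a1, a2, a3⟩ := geo_split hP hx
  obtain ⟨b1, b2, b3⟩ := geo_split hQ hy
  have e := dist_eq_one_iff_adj.2 hxy
  have e' := dist_eq_one_iff_adj.2 hxy.symm
  have m1 := h.2.2.2 x a2.symm
  have m2 := h.2.2.2 y b2.symm
  have t1 := tri a1 hxy.reachable
  have t2 := tri b1 hxy.symm.reachable
  have t3 := tri h.2.2.1 a2.symm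
  have t4 := tri h.2.2.1 b2.symm
  have := a2.pos_dist_of_ne hxc
  have := b2.pos_dist_of_ne hyc
  rw [SimpleGraph.dist_comm (u := c)] at t3 t4
  omega

theorem inter {u v w c x : V} (h : Med G u v w c) {P : G.Walk u c} {Q : G.Walk v c}
    (hP : P.length = G.dist u c) (hQ : Q.length = G.dist v c)
    (hx : x ∈ P.support) (hy : x ∈ Q.support) : x = c := by
  by_contra hxc
  obtain ⟨a1, a2, a3⟩ := geo_split hP hx
  obtain ⟨b1, b2, b3⟩ := geo_split hQ hy
  have m1 := h.2.2.2 x a2.symm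
  have t3 := tri h.2.2.1 a2.symm
  have := a2.pos_dist_of_ne hxc
  rw [SimpleGraph.dist_comm (u := c)] at t3
  omega

/-- two extra edges at `x` are impossible -/
theorem noTwo {u v w c x y z : V} (h : Med G u v w c) {P : G.Walk u c} {Q : G.Walk v c}
    {R : G.Walk w c}
    (hP : P.length = G.dist u c) (hQ : Q.length = G.dist v c) (hR : R.length = G.dist w c)
    (hx : x ∈ P.support) (hy : y ∈ Q.support) (hz : z ∈ R.support)
    (hxy : G.Adj x y) (hxz : G.Adj x z) (hxc : x ≠ c) (hyc : y ≠ c) (hzc : z ≠ c) : False := by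
  obtain ⟨a1, a2, a3⟩ := geo_split hP hx
  obtain ⟨b1, b2, b3⟩ := geo_split hQ hy
  obtain ⟨c1, c2, c3⟩ := geo_split hR hz
  have e := dist_eq_one_iff_adj.2 hxy.symm
  have e' := dist_eq_one_iff_adj.2 hxz.symm
  have m1 := h.2.2.2 x a2.symm
  have t1 := tri b1 hxy.symm.reachable
  have t2 := tri c1 hxz.symm.reachable
  have := a2.pos_dist_of_ne hxc
  have := b2.pos_dist_of_ne hyc
  have := c2.pos_dist_of_ne hzc
  omega

theorem caseB {u v w c x y : V} (h : Med G u v w c) {P : G.Walk u c} {Q : G.Walk v c}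
    {R : G.Walk w c}
    (hP : P.length = G.dist u c) (hQ : Q.length = G.dist v c) (hR : R.length = G.dist w c)
    (hx : x ∈ P.support) (hy : y ∈ Q.support)
    (hxy : G.Adj x y) (hxc : x ≠ c) (hyc : y ≠ c) :
    ∃ (P' : G.Walk u x) (Q' : G.Walk v y),
      P'.IsPath ∧ Q'.IsPath ∧ R.IsPath ∧ G.Adj x c ∧ G.Adj y c ∧
      (∀ z, z ∈ P'.support → z ∉ Q'.support) ∧
      (∀ z, z ∈ P'.support → z ∉ R.support) ∧
      (∀ z, z ∈ Q'.support → z ∉ R.support) ∧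
      (∀ s t, s ∈ P'.support → t ∈ P'.support → G.Adj s t → s(s, t) ∈ P'.edges) ∧
      (∀ s t, s ∈ Q'.support → t ∈ Q'.support → G.Adj s t → s(s, t) ∈ Q'.edges) ∧
      (∀ s t, s ∈ R.support → t ∈ R.support → G.Adj s t → s(s, t) ∈ R.edges) ∧
      (∀ s t, s ∈ P'.support → t ∈ Q'.support → G.Adj s t → s = x ∧ t = y) ∧
      (∀ s t, s ∈ P'.support → t ∈ R.support → G.Adj s t → s = x ∧ t = c) ∧
      (∀ s t, s ∈ Q'.support → t ∈ R.support → G.Adj s t → s = y ∧ t = c) := by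
  classical
  obtain ⟨dx, dy⟩ := cross h hP hQ hx hy hxy hxc hyc
  have gP := geo_take hP hx
  have gQ := geo_take hQ hy
  have sP := P.support_takeUntil_subset_support hx
  have sQ := Q.support_takeUntil_subset_support hy
  have nP : ∀ z, z ∈ (P.takeUntil x hx).support → z ≠ c := by
    rintro z hz rfl
    have := geo_split gP hz
    have := geo_split hP hx
    omega
  have nQ : ∀ z, z ∈ (Q.takeUntil y hy).support → z ≠ c := by
    rintro z hz rfl
    have := geo_split gQ hz
    have := geo_split hQ hy
    omega
  refine ⟨P.takeUntil x hx, Q.takeUntil y hy, Walk.isPath_of_length_eq_dist _ gP,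
    Walk.isPath_of_length_eq_dist _ gQ, Walk.isPath_of_length_eq_dist _ hR,
    dist_eq_one_iff_adj.1 dx, dist_eq_one_iff_adj.1 dy,
    fun z h1 h2 => nP z h1 (inter h hP hQ (sP h1) (sQ h2)),
    fun z h1 h2 => nP z h1 (inter h.s23 hP hR (sP h1) h2),
    fun z h1 h2 => nQ z h1 (inter h.s12.s23 hQ hR (sQ h1) h2),
    fun s t hs ht => geo_edge gP hs ht, fun s t hs ht => geo_edge gQ hs ht,
    fun s t hs ht => geo_edge hR hs ht, ?_, ?_, ?_⟩
  · intro s t hs ht hst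
    obtain ⟨d1, d2⟩ := cross h hP hQ (sP hs) (sQ ht) hst (nP s hs) (nQ t ht)
    exact ⟨geo_uniq hP (sP hs) hx (by omega), geo_uniq hQ (sQ ht) hy (by omega)⟩
  · intro s t hs ht hst
    by_cases htc : t = c
    · subst htc
      have := dist_eq_one_iff_adj.2 hst
      exact ⟨geo_uniq hP (sP hs) hx (by omega), rfl⟩
    · obtain ⟨d1, d2⟩ := cross h.s23 hP hR (sP hs) ht hst (nP s hs) htc
      obtain rfl := geo_uniq hP (sP hs) hx (by omega)
      exact (noTwo h hP hQ hR hx hy ht hxy hst hxc hyc htc).elim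
  · intro s t hs ht hst
    by_cases htc : t = c
    · subst htc
      have := dist_eq_one_iff_adj.2 hst
      exact ⟨geo_uniq hQ (sQ hs) hy (by omega), rfl⟩
    · obtain ⟨d1, d2⟩ := cross h.s12.s23 hQ hR (sQ hs) ht hst (nQ s hs) htc
      obtain rfl := geo_uniq hQ (sQ hs) hy (by omega)
      exact (noTwo h.s12 hQ hP hR hy hx ht hxy.symm hst hyc hxc htc).elim

end ConnAux

open ConnAux

/-- If `u, v, w` are distinct vertices in the same connected component of `G`, then `G`
contains an induced connector with tips `u, v, w`. -/
theorem connector_of_same_component {V : Type*} (G : SimpleGraph V) (u v w : V)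
    (huv : u ≠ v) (huw : u ≠ w) (hvw : v ≠ w)
    (h₁ : G.Reachable u v) (h₂ : G.Reachable u w) :
    HasInducedConnector G u v w := by
  classical
  obtain ⟨c, hm⟩ : ∃ c, Med G u v w c := by
    obtain ⟨c, hc, hmin⟩ := exists_minimalFor_of_wellFoundedLT (fun x => G.Reachable u x)
      (fun x => G.dist u x + G.dist v x + G.dist w x) ⟨u, Reachable.refl u⟩
    refine ⟨c, hc, h₁.symm.trans hc, h₂.symm.trans hc, fun x hx => ?_⟩
    by_contra hlt
    have hle := hmin (hc.trans hx) (le_of_not_ge hlt)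
    exact hlt hle
  obtain ⟨P, hP⟩ := hm.1.exists_walk_length_eq_dist
  obtain ⟨Q, hQ⟩ := hm.2.1.exists_walk_length_eq_dist
  obtain ⟨R, hR⟩ := hm.2.2.1.exists_walk_length_eq_dist
  by_cases k1 : ∃ x y, x ∈ P.support ∧ y ∈ Q.support ∧ G.Adj x y ∧ x ≠ c ∧ y ≠ c
  · obtain ⟨x, y, hx, hy, hxy, hxc, hyc⟩ := k1
    obtain ⟨A, B, p1, p2, p3, j1, j2, n1, n2, n3, e1, e2, e3, f1, f2, f3⟩ :=
      caseB hm hP hQ hR hx hy hxy hxc hyc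
    refine ⟨x, y, c, A, B, R, p1, p2, p3, Or.inr ⟨hxy.ne, hxc, hyc, hxy, j1, j2⟩, ?_, ?_, ?_, ?_⟩
    · intro z; grind
    · intro z; grind
    · intro z; grind
    · intro s t hs ht hst
      have := hst.symm
      rcases hs with hs | hs | hs <;> rcases ht with ht | ht | ht <;> grind
  by_cases k2 : ∃ x y, x ∈ P.support ∧ y ∈ R.support ∧ G.Adj x y ∧ x ≠ c ∧ y ≠ c
  · obtain ⟨x, y, hx, hy, hxy, hxc, hyc⟩ := k2
    obtain ⟨A, B, p1, p2, p3, j1, j2, n1, n2, n3, e1, e2, e3, f1, f2, f3⟩ :=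
      caseB hm.s23 hP hR hQ hx hy hxy hxc hyc
    refine ⟨x, c, y, A, Q, B, p1, p3, p2, Or.inr ⟨hxc, hxy.ne, hyc.symm, j1, hxy, j2.symm⟩, ?_, ?_, ?_, ?_⟩
    · intro z; grind
    · intro z; grind
    · intro z; grind
    · intro s t hs ht hst
      have := hst.symm
      rcases hs with hs | hs | hs <;> rcases ht with ht | ht | ht <;> grind
  by_cases k3 : ∃ x y, x ∈ Q.support ∧ y ∈ R.support ∧ G.Adj x y ∧ x ≠ c ∧ y ≠ c
  · obtain ⟨x, y, hx, hy, hxy, hxc, hyc⟩ := k3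
    obtain ⟨A, B, p1, p2, p3, j1, j2, n1, n2, n3, e1, e2, e3, f1, f2, f3⟩ :=
      caseB hm.s12.s23 hQ hR hP hx hy hxy hxc hyc
    refine ⟨c, x, y, P, A, B, p3, p1, p2, Or.inr ⟨hxc.symm, hyc.symm, hxy.ne, j1.symm, j2.symm, hxy⟩, ?_, ?_, ?_, ?_⟩
    · intro z; grind
    · intro z; grind
    · intro z; grind
    · intro s t hs ht hst
      have := hst.symm
      rcases hs with hs | hs | hs <;> rcases ht with ht | ht | ht <;> grind
  refine ⟨c, c, c, P, Q, R, P.isPath_of_length_eq_dist hP, Q.isPath_of_length_eq_dist hQ,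
    R.isPath_of_length_eq_dist hR, Or.inl ⟨rfl, rfl⟩, fun z => inter hm hP hQ,
    fun z => inter hm.s23 hP hR, fun z => inter hm.s12.s23 hQ hR, ?_⟩
  have e1 := fun x y => @geo_edge V G _ _ x y P hP
  have e2 := fun x y => @geo_edge V G _ _ x y Q hQ
  have e3 := fun x y => @geo_edge V G _ _ x y R hR
  have cP := P.end_mem_support
  have cQ := Q.end_mem_support
  have cR := R.end_mem_support
  intro s t hs ht hst
  have := hst.symm
  rcases hs with hs | hs | hs <;> rcases ht with ht | ht | ht <;> grind
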